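/- For all positive integers a, b, c, d with 1 ≤ a ≤ b ≤ c ≤ 2b and d ≥ max{a, 2(c − b)}, there exists a finite connected simple graph G with ind-match(G) = a, min-match(G) = b, match(G) = c and dim(G) = d. -/

import Mathlib

/-!
Formalization of results from "Matching numbers and dimension of edge ideals"
by A. Hirano and K. Matsuda.

For a finite simple graph `G`:
* a matching is a set of pairwise disjoint edges;
* a maximal matching is one that cannot be enlarged by any edge;
* an induced matching is a matching such that no edge of `G` meets two
  distinct edges of the matching;
* `matchNum`, `minMatchNum`, `indMatchNum` are the corresponding maximum,
  minimum-maximal and maximum-induced sizes;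
* `graphDim K G` is the Krull dimension of `K[V(G)]/I(G)`, where `I(G)` is
  the edge ideal of `G`.
-/

open MvPolynomial
open scoped Classical

noncomputable section

namespace EdgeIdealPaper

variable {V : Type*}

/-- `M` is a matching of `G`: a set of pairwise disjoint edges of `G`. -/
def IsMatching (G : SimpleGraph V) (M : Finset (Sym2 V)) : Prop :=
  (M : Set (Sym2 V)) ⊆ G.edgeSet ∧
    ∀ e ∈ M, ∀ f ∈ M, e ≠ f → ∀ v : V, v ∈ e → v ∉ f

/-- `M` is a maximal matching of `G`: no edge of `G` outside `M` can be added. -/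
def IsMaximalMatching (G : SimpleGraph V) (M : Finset (Sym2 V)) : Prop :=
  IsMatching G M ∧ ∀ e ∈ G.edgeSet, e ∉ M → ¬ IsMatching G (insert e M)

/-- `M` is an induced matching of `G`: a matching such that no edge of `G`
meets two distinct edges of `M`. -/
def IsInducedMatching (G : SimpleGraph V) (M : Finset (Sym2 V)) : Prop :=
  IsMatching G M ∧ ∀ e ∈ G.edgeSet, ∀ f ∈ M, ∀ g ∈ M, f ≠ g →
    ¬ ((∃ v : V, v ∈ e ∧ v ∈ f) ∧ (∃ v : V, v ∈ e ∧ v ∈ g))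

/-- The matching number `match(G)`: maximum size of a matching of `G`. -/
def matchNum (G : SimpleGraph V) : ℕ :=
  sSup {n | ∃ M : Finset (Sym2 V), IsMatching G M ∧ M.card = n}

/-- The minimum matching number `min-match(G)`:
minimum size of a maximal matching of `G`. -/
def minMatchNum (G : SimpleGraph V) : ℕ :=
  sInf {n | ∃ M : Finset (Sym2 V), IsMaximalMatching G M ∧ M.card = n}

/-- The induced matching number `ind-match(G)`:
maximum size of an induced matching of `G`. -/
def indMatchNum (G : SimpleGraph V) : ℕ :=
  sSup {n | ∃ M : Finset (Sym2 V), IsInducedMatching G M ∧ M.card = n}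

/-- The edge ideal `I(G) ⊆ K[x_v : v ∈ V]`, generated by the products
`x_i * x_j` over the edges `{x_i, x_j}` of `G`. -/
def edgeIdeal (K : Type) [Field K] (G : SimpleGraph V) : Ideal (MvPolynomial V K) :=
  Ideal.span {p | ∃ i j : V, G.Adj i j ∧ p = X i * X j}

/-- `dim(G)`: the Krull dimension of the quotient ring `K[V(G)]/I(G)`. -/
def graphDim (K : Type) [Field K] (G : SimpleGraph V) : WithBot ℕ∞ :=
  ringKrullDim (MvPolynomial V K ⧸ edgeIdeal K G)

lemma X_mul_X_mem_edgeIdeal (K : Type) [Field K] {G : SimpleGraph V} {i j : V} (h : G.Adj i j) :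
    (X i * X j : MvPolynomial V K) ∈ edgeIdeal K G :=
  Ideal.subset_span ⟨i, j, h, rfl⟩

lemma card_le_graphDim (K : Type) [Field K] {G : SimpleGraph V} {A : Finset V}
    (hA : G.IsIndepSet A) : (A.card : WithBot ℕ∞) ≤ graphDim K G := by
  have hinj : Function.Injective ((↑) : A → V) := Subtype.val_injective
  have hker : ∀ p ∈ edgeIdeal K G, (killCompl hinj : MvPolynomial V K →ₐ[K] _) p = 0 := by
    intro p hp
    rw [← RingHom.mem_ker]
    refine (Ideal.span_le.2 ?_ : edgeIdeal K G ≤ RingHom.ker (killCompl hinj)) hp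
    rintro _ ⟨i, j, hij, rfl⟩
    rw [SetLike.mem_coe, RingHom.mem_ker, map_mul]
    by_cases hi : i ∈ A
    · have hj : j ∉ A := fun hj => hA hi hj hij.ne hij
      simp [killCompl, hj]
    · simp [killCompl, hi]
  have hsurj : Function.Surjective (Ideal.Quotient.lift (edgeIdeal K G)
      (killCompl hinj : MvPolynomial V K →ₐ[K] MvPolynomial A K).toRingHom hker) :=
    Ideal.Quotient.lift_surjective_of_surjective _ _ fun p =>
      ⟨rename _ p, killCompl_rename_app hinj p⟩
  have := ringKrullDim_le_of_surjective _ hsurj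
  rw [MvPolynomial.ringKrullDim_of_isNoetherianRing] at this
  simpa [graphDim, ringKrullDim_eq_zero_of_field] using this

lemma ringKrullDim_quotient_span_X_le (K : Type) [Field K] [Fintype V] (A : Finset V) :
    ringKrullDim (MvPolynomial V K ⧸
      Ideal.span ((X : V → MvPolynomial V K) '' {v | v ∉ A})) ≤ (A.card : WithBot ℕ∞) := by
  set J := Ideal.span ((X : V → MvPolynomial V K) '' {v | v ∉ A})
  let φ : MvPolynomial A K →ₐ[K] MvPolynomial V K ⧸ J :=
    (Ideal.Quotient.mkₐ K J).comp (rename (↑))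
  have hφ : Function.Surjective φ := by
    rw [← AlgHom.range_eq_top, eq_top_iff]
    have htop : (⊤ : Subalgebra K (MvPolynomial V K ⧸ J)) = (Ideal.Quotient.mkₐ K J).range :=
      ((AlgHom.range_eq_top _).2 (Ideal.Quotient.mkₐ_surjective K J)).symm
    rw [htop, ← Algebra.map_top, ← adjoin_range_X, AlgHom.map_adjoin, Algebra.adjoin_le_iff]
    rintro _ ⟨_, ⟨v, rfl⟩, rfl⟩
    by_cases hv : v ∈ A
    · exact ⟨X ⟨v, hv⟩, by simp [φ]⟩
    · refine ⟨0, ?_⟩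
      have : (X v : MvPolynomial V K) ∈ J := Ideal.subset_span ⟨v, hv, rfl⟩
      simpa [eq_comm] using Ideal.Quotient.eq_zero_iff_mem.2 this
  have := ringKrullDim_le_of_surjective φ.toRingHom hφ
  rw [MvPolynomial.ringKrullDim_of_isNoetherianRing] at this
  simpa [ringKrullDim_eq_zero_of_field] using this

lemma graphDim_le (K : Type) [Field K] [Fintype V] {G : SimpleGraph V} {d : ℕ}
    (h : ∀ A : Finset V, G.IsIndepSet A → A.card ≤ d) : graphDim K G ≤ d := by
  rw [graphDim, ringKrullDim_quotient]
  refine iSup_le fun p => ?_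
  let 𝔭 := p.head.1
  let A : Finset V := {v | (X v : MvPolynomial V K) ∉ 𝔭.asIdeal}
  let J := Ideal.span ((X : V → MvPolynomial V K) '' {v | v ∉ A})
  have hA : G.IsIndepSet A := by
    intro i hi j hj _ hij
    have hmem : (X i * X j : MvPolynomial V K) ∈ 𝔭.asIdeal :=
      p.head.2 (X_mul_X_mem_edgeIdeal K hij)
    rcases 𝔭.2.mem_or_mem hmem with h | h
    · simp [A, h] at hi
    · simp [A, h] at hj
  have hJ : J ≤ 𝔭.asIdeal := by
    refine Ideal.span_le.2 ?_
    rintro _ ⟨v, hv, rfl⟩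
    simpa [A] using hv
  have hmem : ∀ i, (p i).1 ∈ PrimeSpectrum.zeroLocus (J : Set (MvPolynomial V K)) := fun i =>
    hJ.trans (show 𝔭.asIdeal ≤ (p i).1.asIdeal from LTSeries.head_le p i)
  let q : LTSeries (PrimeSpectrum.zeroLocus (J : Set (MvPolynomial V K))) :=
    ⟨p.length, fun i => ⟨(p i).1, hmem i⟩, fun i => p.step i⟩
  have hq : (q.length : WithBot ℕ∞) ≤ _ := Order.LTSeries.length_le_krullDim q
  rw [← ringKrullDim_quotient] at hq
  exact (hq.trans (ringKrullDim_quotient_span_X_le K A)).trans (by exact_mod_cast h A hA)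

lemma graphDim_eq (K : Type) [Field K] [Fintype V] {G : SimpleGraph V} {A : Finset V}
    (hA : G.IsIndepSet A) (h : ∀ B : Finset V, G.IsIndepSet B → B.card ≤ A.card) :
    graphDim K G = A.card :=
  le_antisymm (graphDim_le K h) (card_le_graphDim K hA)

section Matching

variable {G : SimpleGraph V} {M N : Finset (Sym2 V)}

lemma IsMatching.mono (hM : IsMatching G M) (h : N ⊆ M) : IsMatching G N :=
  ⟨fun _ he => hM.1 (h he), fun e he f hf => hM.2 e (h he) f (h hf)⟩

lemma IsMatching.eq_of_mem (hM : IsMatching G M) {e f : Sym2 V} (he : e ∈ M) (hf : f ∈ M) {v : V}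
    (hve : v ∈ e) (hvf : v ∈ f) : e = f := by
  by_contra h
  exact hM.2 e he f hf h v hve hvf

/-- The set of vertices covered by a set of edges. -/
def cover (M : Finset (Sym2 V)) : Finset V := M.biUnion Sym2.toFinset

@[simp] lemma mem_cover {v : V} : v ∈ cover M ↔ ∃ e ∈ M, v ∈ e := by
  simp [cover]

lemma IsMatching.card_cover (hM : IsMatching G M) : (cover M).card = 2 * M.card := by
  rw [cover, Finset.card_biUnion]
  · rw [Finset.sum_congr rfl fun e he =>
      Sym2.card_toFinset_of_not_isDiag e (G.not_isDiag_of_mem_edgeSet (hM.1 he))]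
    simp [mul_comm]
  · intro e he f hf hef
    refine Finset.disjoint_left.2 fun v hve hvf => ?_
    exact hM.2 e he f hf hef v (Sym2.mem_toFinset.1 hve) (Sym2.mem_toFinset.1 hvf)

lemma IsMaximalMatching.mem_cover_or (hM : IsMaximalMatching G M) {u v : V} (h : G.Adj u v) :
    u ∈ cover M ∨ v ∈ cover M := by
  by_contra! hc
  simp only [mem_cover, not_exists, not_and] at hc
  have hnew : ∀ e ∈ M, ∀ w ∈ s(u, v), w ∉ e := by
    intro e he w hw
    rcases Sym2.mem_iff.1 hw with rfl | rfl
    exacts [hc.1 e he, hc.2 e he]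
  refine hM.2 s(u, v) h (fun hmem => hc.1 _ hmem (Sym2.mem_mk_left u v)) ⟨?_, ?_⟩
  · intro e he
    rcases Finset.mem_insert.1 he with rfl | he
    exacts [h, hM.1.1 he]
  · intro e he e' he' hne w hw hw'
    rcases Finset.mem_insert.1 he with rfl | he <;> rcases Finset.mem_insert.1 he' with rfl | he'
    · exact hne rfl
    · exact hnew e' he' w hw hw'
    · exact hnew e he w hw' hw
    · exact hM.1.2 e he e' he' hne w hw hw'

/-- A matching covers at most one of a set of vertices that it can only match with `w`. -/
lemma IsMatching.card_filter_cover_le_one (hM : IsMatching G M) (D : V → Prop)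
    [DecidablePred D] (w : V)
    (h : ∀ e ∈ M, ∀ v ∈ e, D v → e = s(v, w)) : ((cover M).filter D).card ≤ 1 := by
  rw [Finset.card_le_one]
  intro u hu v hv
  simp only [Finset.mem_filter, mem_cover] at hu hv
  obtain ⟨⟨e, he, hue⟩, hDu⟩ := hu
  obtain ⟨⟨e', he', hve⟩, hDv⟩ := hv
  have h1 := h e he u hue hDu
  have h2 := h e' he' v hve hDv
  have heq := hM.eq_of_mem he he' (v := w) (by simp [h1]) (by simp [h2])
  exact Sym2.congr_left.1 (h1.symm.trans (heq.trans h2))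

lemma IsMatching.isMaximalMatching (hM : IsMatching G M)
    (h : ∀ e ∈ G.edgeSet, ∃ f ∈ M, ∃ v, v ∈ e ∧ v ∈ f) : IsMaximalMatching G M := by
  refine ⟨hM, fun e he hne hins => hne ?_⟩
  obtain ⟨f, hf, v, hve, hvf⟩ := h e he
  rwa [hins.eq_of_mem (Finset.mem_insert_self _ _) (Finset.mem_insert_of_mem hf) hve hvf]

lemma exists_isMatching_of_family {κ : Type*} [Fintype κ] {φ : κ → Sym2 V}
    (hφ : ∀ k, φ k ∈ G.edgeSet) (h : ∀ k l v, v ∈ φ k → v ∈ φ l → k = l) :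
    ∃ M, IsMatching G M ∧ M.card = Fintype.card κ ∧ ∀ e, e ∈ M ↔ ∃ k, φ k = e := by
  refine ⟨Finset.univ.image φ, ⟨?_, ?_⟩, ?_, by simp⟩
  · intro e he
    obtain ⟨k, -, rfl⟩ := Finset.mem_image.1 he
    exact hφ k
  · intro e he f hf hne v hv hv'
    obtain ⟨k, -, rfl⟩ := Finset.mem_image.1 he
    obtain ⟨l, -, rfl⟩ := Finset.mem_image.1 hf
    exact hne (congrArg φ (h k l v hv hv'))
  · refine (Finset.card_image_of_injective _ fun k l hkl => ?_).trans Finset.card_univ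
    exact h k l _ (Sym2.out_fst_mem (φ k)) (hkl ▸ Sym2.out_fst_mem (φ k))

lemma matchNum_eq {n : ℕ} (hM : IsMatching G M) (hn : M.card = n)
    (h : ∀ N, IsMatching G N → N.card ≤ n) : matchNum G = n :=
  IsGreatest.csSup_eq ⟨⟨M, hM, hn⟩, by rintro _ ⟨N, hN, rfl⟩; exact h N hN⟩

lemma minMatchNum_eq {n : ℕ} (hM : IsMaximalMatching G M) (hn : M.card = n)
    (h : ∀ N, IsMaximalMatching G N → n ≤ N.card) : minMatchNum G = n :=
  IsLeast.csInf_eq ⟨⟨M, hM, hn⟩, by rintro _ ⟨N, hN, rfl⟩; exact h N hN⟩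

lemma indMatchNum_eq {n : ℕ} (hM : IsInducedMatching G M) (hn : M.card = n)
    (h : ∀ N, IsInducedMatching G N → N.card ≤ n) : indMatchNum G = n :=
  IsGreatest.csSup_eq ⟨⟨M, hM, hn⟩, by rintro _ ⟨N, hN, rfl⟩; exact h N hN⟩

end Matching

section CliqueGraph

variable {P ι S : Type*}

/-- The graph whose vertices are those of disjoint cliques, the clique of label `i` having the
vertices `(p, t)` with `f p = i`, together with an independent set `S`, a vertex `s` of which is
joined to the clique vertices `x` with `R s x`. -/
def cliqueGraph (f : P → ι) (R : S → P × Bool → Prop) : SimpleGraph (P × Bool ⊕ S) where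
  Adj
    | .inl x, .inl y => x ≠ y ∧ f x.1 = f y.1
    | .inl x, .inr s => R s x
    | .inr s, .inl x => R s x
    | .inr _, .inr _ => False
  symm := ⟨by
    rintro (x | s) (y | t) h
    exacts [⟨h.1.symm, h.2.symm⟩, h, h, h]⟩
  loopless := ⟨by
    rintro (x | s) h
    exacts [h.1 rfl, h]⟩

variable {f : P → ι} {R : S → P × Bool → Prop}

@[simp] lemma cliqueGraph_adj_inl_inl {x y : P × Bool} :
    (cliqueGraph f R).Adj (.inl x) (.inl y) ↔ x ≠ y ∧ f x.1 = f y.1 := Iff.rfl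

@[simp] lemma cliqueGraph_adj_inl_inr {x : P × Bool} {s : S} :
    (cliqueGraph f R).Adj (.inl x) (.inr s) ↔ R s x := Iff.rfl

@[simp] lemma cliqueGraph_adj_inr_inl {x : P × Bool} {s : S} :
    (cliqueGraph f R).Adj (.inr s) (.inl x) ↔ R s x := Iff.rfl

/-- The edge `e` has an endpoint in the clique of label `i`. -/
def Touches (f : P → ι) (i : ι) (e : Sym2 (P × Bool ⊕ S)) : Prop :=
  ∃ x : P × Bool, f x.1 = i ∧ .inl x ∈ e

lemma exists_inl_mem {e : Sym2 (P × Bool ⊕ S)} (he : e ∈ (cliqueGraph f R).edgeSet) :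
    ∃ x : P × Bool, .inl x ∈ e := by
  induction e with | _ u v
  rcases u with x | s
  · exact ⟨x, Sym2.mem_mk_left _ _⟩
  · rcases v with y | t
    · exact ⟨y, Sym2.mem_mk_right _ _⟩
    · exact he.elim

lemma label_eq_of_mem {e : Sym2 (P × Bool ⊕ S)} (he : e ∈ (cliqueGraph f R).edgeSet)
    {x y : P × Bool} (hx : .inl x ∈ e) (hy : .inl y ∈ e) : f x.1 = f y.1 := by
  by_cases hxy : x = y
  · rw [hxy]
  · have : e = s(.inl x, .inl y) := (Sym2.mem_and_mem_iff (by simpa using hxy)).1 ⟨hx, hy⟩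
    subst this
    exact he.2

lemma eq_mk_of_inr_mem {e : Sym2 (P × Bool ⊕ S)} (he : e ∈ (cliqueGraph f R).edgeSet) {s : S}
    (hs : .inr s ∈ e) {x : P × Bool} (hx : .inl x ∈ e) : e = s(.inr s, .inl x) ∧ R s x := by
  have : e = s(.inr s, .inl x) := (Sym2.mem_and_mem_iff (by simp)).1 ⟨hs, hx⟩
  subst this
  exact ⟨rfl, he⟩

lemma IsMatching.card_eq_sum_touches [Fintype ι] {M : Finset (Sym2 (P × Bool ⊕ S))}
    (hM : IsMatching (cliqueGraph f R) M) : M.card = ∑ i, (M.filter (Touches f i)).card := by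
  rw [← Finset.card_biUnion]
  · congr 1
    ext e
    simp only [Finset.mem_biUnion, Finset.mem_univ, Finset.mem_filter, true_and]
    refine ⟨fun he => ?_, fun ⟨_, he, _⟩ => he⟩
    obtain ⟨x, hx⟩ := exists_inl_mem (hM.1 he)
    exact ⟨_, he, x, rfl, hx⟩
  · intro i _ j _ hij
    refine Finset.disjoint_left.2 fun e he he' => hij ?_
    obtain ⟨heM, x, rfl, hx⟩ := Finset.mem_filter.1 he
    obtain ⟨-, y, rfl, hy⟩ := Finset.mem_filter.1 he'
    exact label_eq_of_mem (hM.1 heM) hx hy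

lemma card_eq_sum_card_fiber [Fintype P] [Fintype ι] (f : P → ι) :
    Fintype.card P = ∑ i, (Finset.univ.filter fun p => f p = i).card :=
  Finset.card_eq_sum_card_fiberwise fun _ _ => Finset.mem_coe.2 (Finset.mem_univ _)

/-- The vertices of the clique of label `i`. -/
def clique [Fintype P] (S : Type*) (f : P → ι) (i : ι) : Finset (P × Bool ⊕ S) :=
  ((Finset.univ.filter fun p => f p = i) ×ˢ Finset.univ).map .inl

lemma card_clique [Fintype P] (i : ι) :
    (clique S f i).card = 2 * (Finset.univ.filter fun p => f p = i).card := by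
  simp [clique, mul_comm]

lemma inl_mem_clique [Fintype P] {i : ι} {x : P × Bool} :
    (.inl x : P × Bool ⊕ S) ∈ clique S f i ↔ f x.1 = i := by
  simp [clique]

lemma exists_of_mem_clique [Fintype P] {i : ι} {v : P × Bool ⊕ S} (hv : v ∈ clique S f i) :
    ∃ x : P × Bool, f x.1 = i ∧ v = .inl x := by
  rcases v with x | s
  · exact ⟨x, inl_mem_clique.1 hv, rfl⟩
  · simp [clique] at hv

lemma IsMaximalMatching.card_le [Fintype P] [Fintype ι] {M : Finset (Sym2 (P × Bool ⊕ S))}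
    (hM : IsMaximalMatching (cliqueGraph f R) M) : Fintype.card P ≤ M.card := by
  rw [hM.1.card_eq_sum_touches, card_eq_sum_card_fiber f]
  refine Finset.sum_le_sum fun i _ => ?_
  have hcov := (hM.1.mono (Finset.filter_subset (Touches f i) M)).card_cover
  have hone : (clique S f i \ cover (M.filter (Touches f i))).card ≤ 1 := by
    rw [Finset.card_le_one]
    intro u hu v hv
    rw [Finset.mem_sdiff] at hu hv
    obtain ⟨x, hx, rfl⟩ := exists_of_mem_clique hu.1
    obtain ⟨y, hy, rfl⟩ := exists_of_mem_clique hv.1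
    by_contra hne
    have hadj : (cliqueGraph f R).Adj (.inl x) (.inl y) :=
      ⟨fun h => hne (congrArg _ h), hx.trans hy.symm⟩
    rcases hM.mem_cover_or hadj with h | h
    · obtain ⟨e, he, hxe⟩ := mem_cover.1 h
      exact hu.2 (mem_cover.2 ⟨e, Finset.mem_filter.2 ⟨he, x, hx, hxe⟩, hxe⟩)
    · obtain ⟨e, he, hye⟩ := mem_cover.1 h
      exact hv.2 (mem_cover.2 ⟨e, Finset.mem_filter.2 ⟨he, y, hy, hye⟩, hye⟩)
  have := Finset.le_card_sdiff (cover (M.filter (Touches f i))) (clique S f i)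
  have hcl := card_clique (S := S) (f := f) i
  omega

lemma IsInducedMatching.card_le [Fintype ι] {M : Finset (Sym2 (P × Bool ⊕ S))}
    (hM : IsInducedMatching (cliqueGraph f R) M) : M.card ≤ Fintype.card ι := by
  rw [hM.1.card_eq_sum_touches, Fintype.card_eq_sum_ones]
  refine Finset.sum_le_sum fun i _ => Finset.card_le_one.2 fun e he e' he' => ?_
  obtain ⟨he, x, hx, hxe⟩ := Finset.mem_filter.1 he
  obtain ⟨he', y, hy, hye⟩ := Finset.mem_filter.1 he'
  by_contra hne
  have hxy : x ≠ y := by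
    rintro rfl
    exact hM.1.2 e he e' he' hne _ hxe hye
  exact hM.2 s(.inl x, .inl y) ⟨hxy, hx.trans hy.symm⟩ e he e' he' hne
    ⟨⟨_, Sym2.mem_mk_left _ _, hxe⟩, ⟨_, Sym2.mem_mk_right _ _, hye⟩⟩

/-- The edge joining the two vertices `(p, false)` and `(p, true)`. -/
def rung (S : Type*) (p : P) : Sym2 (P × Bool ⊕ S) := s(.inl (p, false), .inl (p, true))

lemma mem_rung {p : P} {v : P × Bool ⊕ S} : v ∈ rung S p ↔ ∃ t, v = .inl (p, t) := by
  simp [rung, Bool.exists_bool]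

lemma rung_mem_edgeSet (p : P) : rung S p ∈ (cliqueGraph f R).edgeSet := by
  simp [rung]

lemma eq_of_mem_rung {p q : P} {v : P × Bool ⊕ S} (hp : v ∈ rung S p) (hq : v ∈ rung S q) :
    p = q := by
  obtain ⟨t, rfl⟩ := mem_rung.1 hp
  obtain ⟨u, h⟩ := mem_rung.1 hq
  simp at h
  exact h.1

variable (f R) in
lemma exists_isMaximalMatching_card_eq [Fintype P] :
    ∃ M, IsMaximalMatching (cliqueGraph f R) M ∧ M.card = Fintype.card P := by
  obtain ⟨M, hM, hcard, hmem⟩ := exists_isMatching_of_family (G := cliqueGraph f R) (φ := rung S)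
    rung_mem_edgeSet fun _ _ _ => eq_of_mem_rung
  refine ⟨M, hM.isMaximalMatching fun e he => ?_, hcard⟩
  obtain ⟨x, hx⟩ := exists_inl_mem he
  exact ⟨rung S x.1, (hmem _).2 ⟨_, rfl⟩, _, hx, mem_rung.2 ⟨x.2, rfl⟩⟩

lemma minMatchNum_cliqueGraph [Fintype P] [Fintype ι] :
    minMatchNum (cliqueGraph f R) = Fintype.card P := by
  obtain ⟨M, hM, hcard⟩ := exists_isMaximalMatching_card_eq f R
  exact minMatchNum_eq hM hcard fun _ hN => hN.card_le

variable {g : ι → P}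

lemma indMatchNum_cliqueGraph [Fintype ι] (hfg : Function.LeftInverse f g) :
    indMatchNum (cliqueGraph f R) = Fintype.card ι := by
  obtain ⟨M, hM, hcard, hmem⟩ := exists_isMatching_of_family (G := cliqueGraph f R)
    (φ := fun i => rung S (g i)) (fun _ => rung_mem_edgeSet _)
    fun _ _ _ h h' => hfg.injective (eq_of_mem_rung h h')
  refine indMatchNum_eq ⟨hM, ?_⟩ hcard fun _ hN => hN.card_le
  rintro e he e₁ he₁ e₂ he₂ hne ⟨⟨u, hu, hu₁⟩, v, hv, hv₂⟩
  obtain ⟨i, rfl⟩ := (hmem _).1 he₁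
  obtain ⟨j, rfl⟩ := (hmem _).1 he₂
  obtain ⟨t, rfl⟩ := mem_rung.1 hu₁
  obtain ⟨t', rfl⟩ := mem_rung.1 hv₂
  have := label_eq_of_mem he hu hv
  simp only [hfg i, hfg j] at this
  exact hne (by rw [this])

lemma connected_cliqueGraph (s₀ : S) (h₀ : ∀ i, ∃ x : P × Bool, f x.1 = i ∧ R s₀ x)
    (h : ∀ s, ∃ x, R s x) : (cliqueGraph f R).Connected := by
  have hinl : ∀ x : P × Bool, (cliqueGraph f R).Reachable (.inr s₀) (.inl x) := by
    intro x
    obtain ⟨y, hy, hR⟩ := h₀ (f x.1)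
    have hsy : (cliqueGraph f R).Reachable (.inr s₀) (.inl y) :=
      SimpleGraph.Adj.reachable (cliqueGraph_adj_inr_inl.2 hR)
    by_cases hxy : y = x
    · exact hxy ▸ hsy
    · exact hsy.trans (SimpleGraph.Adj.reachable (cliqueGraph_adj_inl_inl.2 ⟨hxy, hy⟩))
  rw [SimpleGraph.connected_iff_exists_forall_reachable]
  refine ⟨.inr s₀, ?_⟩
  rintro (x | s)
  · exact hinl x
  · obtain ⟨x, hx⟩ := h s
    exact (hinl x).trans (SimpleGraph.Adj.reachable (cliqueGraph_adj_inl_inr.2 hx))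

/-- If every vertex outside the cliques has at most one neighbour in each clique, and these
neighbours agree, then the matching number is that of the union of the cliques. -/
lemma matchNum_cliqueGraph_of_section [Fintype P] [Fintype ι] (hfg : Function.LeftInverse f g)
    (hR : ∀ s x, R s x → ∃ i, x = (g i, false)) :
    matchNum (cliqueGraph f R) = Fintype.card P := by
  obtain ⟨M₀, hM₀, hcard⟩ := exists_isMaximalMatching_card_eq f R
  refine matchNum_eq hM₀.1 hcard fun M hM => ?_
  rw [hM.card_eq_sum_touches, card_eq_sum_card_fiber f]
  refine Finset.sum_le_sum fun i _ => ?_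
  have hMi := hM.mono (Finset.filter_subset (Touches f i) M)
  have hcov := hMi.card_cover
  have hone := hMi.card_filter_cover_le_one (fun v => v ∉ clique S f i) (.inl (g i, false)) (by
    intro e he v hv hvi
    obtain ⟨he, x, hx, hxe⟩ := Finset.mem_filter.1 he
    rcases v with y | s
    · exact absurd (inl_mem_clique.2 ((label_eq_of_mem (hM.1 he) hv hxe).trans hx)) hvi
    · obtain ⟨h1, h2⟩ := eq_mk_of_inr_mem (hM.1 he) hv hxe
      obtain ⟨j, rfl⟩ := hR s x h2
      rw [h1, ← hx, hfg j])
  have hsplit := Finset.card_filter_add_card_filter_not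
    (s := cover (M.filter (Touches f i))) (fun v => v ∈ clique S f i)
  have hle : ((cover (M.filter (Touches f i))).filter fun v => v ∈ clique S f i).card ≤
      (clique S f i).card := Finset.card_le_card fun v hv => (Finset.mem_filter.1 hv).2
  have hcl := card_clique (S := S) (f := f) i
  omega

/-- The adjacency between the independent set `S₀ ⊕ S₁` and the cliques in which the vertices of
`S₀` are joined to everything, and those of `S₁` only to the vertex `(g i, false)` of the clique
of label `i`, for each `i ∈ J`. -/
def joinRel {S₀ S₁ : Type*} (g : ι → P) (J : Set ι) : S₀ ⊕ S₁ → P × Bool → Prop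
  | .inl _, _ => True
  | .inr _, x => ∃ i ∈ J, x = (g i, false)

variable {S₀ S₁ : Type*} {J : Set ι}

lemma graphDim_cliqueGraph (K : Type) [Field K] [Fintype P] [Fintype ι] [Fintype S₀] [Fintype S₁]
    (hfg : Function.LeftInverse f g) :
    graphDim K (cliqueGraph f (joinRel g J : S₀ ⊕ S₁ → _)) =
      (max (Fintype.card S₀) (Fintype.card ι) + Fintype.card S₁ : ℕ) := by
  set G := cliqueGraph f (joinRel g J : S₀ ⊕ S₁ → _)
  have hle : ∀ B : Finset (P × Bool ⊕ (S₀ ⊕ S₁)), G.IsIndepSet B →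
      B.card ≤ max (Fintype.card S₀) (Fintype.card ι) + Fintype.card S₁ := by
    intro B hB
    have h1 := B.card_toLeft_add_card_toRight
    have h2 := B.toRight.card_toLeft_add_card_toRight
    have h3 : B.toRight.toLeft.card ≤ Fintype.card S₀ := Finset.card_le_univ _
    have h4 : B.toRight.toRight.card ≤ Fintype.card S₁ := Finset.card_le_univ _
    have h5 : B.toLeft.card ≤ Fintype.card ι := by
      refine Finset.card_le_card_of_injOn (fun x => f x.1) (fun _ _ => by simp) ?_
      intro x hx y hy hxy
      by_contra hne
      exact hB (Finset.mem_toLeft.1 hx) (Finset.mem_toLeft.1 hy) (by simpa using hne) ⟨hne, hxy⟩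
    have h6 : B.toRight.toLeft.card = 0 ∨ B.toLeft.card = 0 := by
      by_contra! h
      obtain ⟨s, hs⟩ := Finset.card_ne_zero.1 h.1
      obtain ⟨x, hx⟩ := Finset.card_ne_zero.1 h.2
      exact hB (Finset.mem_toLeft.1 hx) (Finset.mem_toRight.1 (Finset.mem_toLeft.1 hs))
        (by simp) trivial
    omega
  have hex : ∃ B : Finset (P × Bool ⊕ (S₀ ⊕ S₁)), G.IsIndepSet B ∧
      B.card = max (Fintype.card S₀) (Fintype.card ι) + Fintype.card S₁ := by
    rcases le_total (Fintype.card ι) (Fintype.card S₀) with h | h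
    · refine ⟨Finset.disjSum ∅ Finset.univ, ?_, by simp [h]⟩
      rintro (x | s) hx (y | t) hy _ hadj
      · simp at hx
      · simp at hx
      · simp at hy
      · exact hadj
    · let B₀ : Finset (P × Bool) := Finset.univ.image fun i => (g i, true)
      let B₁ : Finset (S₀ ⊕ S₁) := Finset.disjSum ∅ Finset.univ
      have hB₀ : B₀.card = Fintype.card ι :=
        Finset.card_image_of_injective _ fun i j hij => hfg.injective (Prod.ext_iff.1 hij).1
      refine ⟨Finset.disjSum B₀ B₁, ?_, by simp [h, hB₀, B₁]⟩
      have hnot : ∀ x s, .inl x ∈ Finset.disjSum B₀ B₁ → s ∈ B₁ → ¬ joinRel g J s x := by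
        rintro x (s | s) hx hs
        · simp [B₁] at hs
        · rintro ⟨j, -, rfl⟩
          simp [B₀] at hx
      rintro (x | s) hx (y | t) hy hne hadj
      · obtain ⟨i, -, rfl⟩ := Finset.mem_image.1 (Finset.inl_mem_disjSum.1 hx)
        obtain ⟨j, -, rfl⟩ := Finset.mem_image.1 (Finset.inl_mem_disjSum.1 hy)
        have hij : f (g i) = f (g j) := hadj.2
        rw [hfg, hfg] at hij
        exact hne (by rw [hij])
      · exact hnot x t hx (Finset.inr_mem_disjSum.1 hy) hadj
      · exact hnot y s hy (Finset.inr_mem_disjSum.1 hx) hadj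
      · exact hadj
  obtain ⟨B, hB, hcard⟩ := hex
  rw [← hcard]
  exact graphDim_eq K hB fun A hA => (hle A hA).trans_eq hcard.symm

lemma IsMatching.two_mul_card_le [Fintype P] [Fintype S₀] [Fintype S₁] (i₀ : ι)
    {M : Finset (Sym2 (P × Bool ⊕ (S₀ ⊕ S₁)))}
    (hM : IsMatching (cliqueGraph f (joinRel g {i₀})) M) :
    2 * M.card ≤ 2 * Fintype.card P + Fintype.card S₀ + min 1 (Fintype.card S₁) := by
  rw [← hM.card_cover, ← Finset.card_toLeft_add_card_toRight,
    ← Finset.card_toLeft_add_card_toRight (u := (cover M).toRight)]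
  have h1 : (cover M).toLeft.card ≤ Fintype.card (P × Bool) := Finset.card_le_univ _
  have h2 : (cover M).toRight.toLeft.card ≤ Fintype.card S₀ := Finset.card_le_univ _
  have h3 : (cover M).toRight.toRight.card ≤ Fintype.card S₁ := Finset.card_le_univ _
  have h4 := hM.card_filter_cover_le_one (fun v => ∃ s, v = .inr (.inr s)) (.inl (g i₀, false)) (by
    rintro e he v hv ⟨s, rfl⟩
    obtain ⟨x, hx⟩ := exists_inl_mem (hM.1 he)
    obtain ⟨h, i, rfl, rfl⟩ := eq_mk_of_inr_mem (hM.1 he) hv hx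
    exact h)
  have h5 : (cover M).toRight.toRight.card ≤
      ((cover M).filter fun v => ∃ s, v = .inr (.inr s)).card :=
    Finset.card_le_card_of_injOn (fun s => .inr (.inr s))
      (fun s hs => by simpa using hs) (fun s _ t _ h => by simpa using h)
  simp only [Fintype.card_prod, Fintype.card_bool] at h1
  omega

/-- The edges of a large matching: the vertices of the `rung`s at `h q` are matched with
`S₀ = Q × Bool` instead of each other. -/
def swapEdge {Q : Type*} (S₁ : Type*) (h : Q → P) : P ⊕ Q → Sym2 (P × Bool ⊕ (Q × Bool ⊕ S₁))
  | .inl p => if hp : ∃ q, h q = p then s(.inl (p, false), .inr (.inl (hp.choose, false)))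
      else rung _ p
  | .inr q => s(.inl (h q, true), .inr (.inl (q, true)))

lemma exists_isMatching_card_eq_add {Q : Type*} [Fintype P] [Fintype Q] {h : Q → P}
    (hh : Function.Injective h) :
    ∃ M, IsMatching (cliqueGraph f (joinRel g J : Q × Bool ⊕ S₁ → _)) M ∧
      M.card = Fintype.card P + Fintype.card Q := by
  obtain ⟨M, hM, hcard, -⟩ := exists_isMatching_of_family (φ := swapEdge S₁ h)
      (G := cliqueGraph f (joinRel g J : Q × Bool ⊕ S₁ → _)) (by
    rintro (p | q)
    · by_cases hp : ∃ q, h q = p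
      · simp [swapEdge, hp, joinRel]
      · simpa [swapEdge, hp] using rung_mem_edgeSet p
    · simp [swapEdge, joinRel]) (by
    have key : ∀ p q v, v ∈ swapEdge S₁ h (.inl p) → v ∉ swapEdge S₁ h (.inr q) := by
      intro p q v hv hv'
      by_cases hp : ∃ q, h q = p
      · simp only [swapEdge, hp, dite_true, Sym2.mem_iff] at hv hv'
        rcases hv with rfl | rfl <;> simp at hv'
      · simp only [swapEdge, hp, dite_false, mem_rung, Sym2.mem_iff] at hv hv'
        obtain ⟨t, rfl⟩ := hv
        simp only [Sum.inl.injEq, Prod.mk.injEq, reduceCtorEq, or_false] at hv'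
        exact hp ⟨q, hv'.1.symm⟩
    rintro (p | q) (p' | q') v hv hv'
    · congr 1
      by_cases hp : ∃ q, h q = p <;> by_cases hp' : ∃ q, h q = p'
      · simp only [swapEdge, hp, hp', dite_true, Sym2.mem_iff] at hv hv'
        rcases hv with rfl | rfl
        · simpa using hv'
        · simp only [reduceCtorEq, Sum.inr.injEq, Sum.inl.injEq, Prod.mk.injEq, and_true,
            false_or] at hv'
          rw [← hp.choose_spec, ← hp'.choose_spec, hv']
      · simp only [swapEdge, hp, hp', dite_true, dite_false, mem_rung, Sym2.mem_iff] at hv hv'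
        obtain ⟨t, rfl⟩ := hv'
        simp at hv
        exact hv.1.symm
      · simp only [swapEdge, hp, hp', dite_true, dite_false, mem_rung, Sym2.mem_iff] at hv hv'
        obtain ⟨t, rfl⟩ := hv
        simp at hv'
        exact hv'.1
      · simp only [swapEdge, hp, hp', dite_false] at hv hv'
        exact eq_of_mem_rung hv hv'
    · exact absurd hv' (key p q' v hv)
    · exact absurd hv (key p' q v hv')
    · congr 1
      simp only [swapEdge, Sym2.mem_iff] at hv hv'
      rcases hv with rfl | rfl
      · simpa [hh.eq_iff] using hv'
      · simpa using hv')
  exact ⟨M, hM, hcard.trans Fintype.card_sum⟩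

end CliqueGraph

/-- For all positive integers `a, b, c, d` with `1 ≤ a ≤ b ≤ c ≤ 2b` and
`d ≥ max {a, 2(c - b)}`, there exists a finite connected simple graph `G` with
`ind-match(G) = a`, `min-match(G) = b`, `match(G) = c` and `dim(G) = d`. -/
theorem exists_graph (a b c d : ℕ) (ha : 1 ≤ a) (hab : a ≤ b) (hbc : b ≤ c)
    (hc2b : c ≤ 2 * b) (hd : 1 ≤ d) (hmax : max a (2 * (c - b)) ≤ d)
    (K : Type) [Field K] :
    ∃ (V : Type) (_ : Fintype V) (G : SimpleGraph V), G.Connected ∧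
      indMatchNum G = a ∧ minMatchNum G = b ∧ matchNum G = c ∧
      graphDim K G = (d : WithBot ℕ∞) := by
  let f : Fin b → Fin a := fun p => ⟨min p (a - 1), by omega⟩
  let g : Fin a → Fin b := Fin.castLE hab
  have hfg : Function.LeftInverse f g := fun i => Fin.ext (by simp [f, g]; omega)
  have had : a ≤ d := (le_max_left _ _).trans hmax
  have hcd : 2 * (c - b) ≤ d := (le_max_right _ _).trans hmax
  let i₀ : Fin a := ⟨0, ha⟩
  rcases hbc.eq_or_lt with rfl | hlt
  · rcases had.eq_or_lt with rfl | hlt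
    · refine ⟨_, inferInstance, cliqueGraph f (joinRel g {i₀} : Unit ⊕ Empty → _), ?_, ?_, ?_, ?_,
        ?_⟩
      · refine connected_cliqueGraph (.inl ()) (fun i => ⟨(g i, true), hfg i, trivial⟩) ?_
        rintro (_ | s)
        exacts [⟨(g i₀, true), trivial⟩, s.elim]
      · simp [indMatchNum_cliqueGraph hfg]
      · simp [minMatchNum_cliqueGraph]
      · obtain ⟨M, hM, hcard⟩ := exists_isMaximalMatching_card_eq f
          (joinRel g {i₀} : Unit ⊕ Empty → _)
        refine matchNum_eq hM.1 (by simpa using hcard) fun N hN => ?_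
        have := hN.two_mul_card_le
        simp at this
        omega
      · simp [graphDim_cliqueGraph K hfg, ha]
    · let s₀ : Fin (d - a) := ⟨0, by omega⟩
      refine ⟨_, inferInstance, cliqueGraph f (joinRel g Set.univ : Empty ⊕ Fin (d - a) → _),
        ?_, ?_, ?_, ?_, ?_⟩
      · refine connected_cliqueGraph (.inr s₀)
          (fun i => ⟨(g i, false), hfg i, i, trivial, rfl⟩) ?_
        rintro (s | s)
        exacts [s.elim, ⟨(g i₀, false), i₀, trivial, rfl⟩]
      · simp [indMatchNum_cliqueGraph hfg]
      · simp [minMatchNum_cliqueGraph]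
      · rw [matchNum_cliqueGraph_of_section hfg, Fintype.card_fin]
        rintro (s | s) x hx
        · exact s.elim
        · obtain ⟨i, -, h⟩ := hx
          exact ⟨i, h⟩
      · rw [graphDim_cliqueGraph K hfg]
        simp only [Fintype.card_fin, Fintype.card_empty]
        congr 2
        omega
  · have hm : c - b ≤ b := by omega
    let q₀ : Fin (c - b) := ⟨0, by omega⟩
    refine ⟨_, inferInstance, cliqueGraph f
      (joinRel g {i₀} : (Fin (c - b) × Bool) ⊕ Fin (d - max (2 * (c - b)) a) → _),
      ?_, ?_, ?_, ?_, ?_⟩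
    · refine connected_cliqueGraph (.inl (q₀, true)) (fun i => ⟨(g i, true), hfg i, trivial⟩) ?_
      rintro (_ | s)
      exacts [⟨(g i₀, true), trivial⟩, ⟨(g i₀, false), i₀, rfl, rfl⟩]
    · simp [indMatchNum_cliqueGraph hfg]
    · simp [minMatchNum_cliqueGraph]
    · obtain ⟨M, hM, hcard⟩ := exists_isMatching_card_eq_add (f := f) (g := g) (J := {i₀})
        (S₁ := Fin (d - max (2 * (c - b)) a)) (Fin.castLE_injective hm)
      refine matchNum_eq hM (by simp at hcard; omega) fun N hN => ?_
      have := hN.two_mul_card_le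
      simp only [Fintype.card_prod, Fintype.card_fin, Fintype.card_bool] at this
      omega
    · rw [graphDim_cliqueGraph K hfg]
      simp only [Fintype.card_fin, Fintype.card_prod, Fintype.card_bool]
      congr 2
      omega

end EdgeIdealPaper
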